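/- arXiv:2209.00527 — 8 statements merged into one kernel-verified Lean document; each statement's English description precedes it below -/
import Mathlib

section
/- Let μ, T, dt > 0, let P be a probability density on ℝ^d, let F, ν : ℝ^d → ℝ^d be measurable vector fields with ∫ ‖ν‖² P dx < ∞, and define σ = (1/(μT)) ∫ ‖ν‖² P dx. For θ ∈ [0,1] define the interpolated joint density ℙ^θ(y,x) = g^θ(y|x)·P(x), where g^θ(·|x) is the Gaussian density with mean x + μF(x)·dt − 2θ·ν(x)·dt and covariance 2μT·dt·Id. Then for all θ, θ' ∈ [0,1], D_KL(ℙ^θ ‖ ℙ^{θ'}) = (θ − θ')² · dt · σ. In particular, the entropy production rate σ equals D_KL(ℙ^θ ‖ ℙ^{θ'}) / ((θ − θ')² dt) for any θ ≠ θ'. -/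
open MeasureTheory

/-- KL divergence between two densities `p, q` with respect to a measure `μ`. -/
noncomputable def KL {α : Type*} [MeasurableSpace α] (μ : Measure α) (p q : α → ℝ) : ℝ :=
  ∫ x, p x * Real.log (p x / q x) ∂μ

/-- The Gaussian density on `ℝ^d` with mean `m` and covariance `s·Id`. -/
noncomputable def gaussDensity {d : ℕ} (m : EuclideanSpace ℝ (Fin d)) (s : ℝ)
    (y : EuclideanSpace ℝ (Fin d)) : ℝ :=
  (2 * Real.pi * s) ^ (-(d : ℝ) / 2) * Real.exp (-‖y - m‖ ^ 2 / (2 * s))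

lemma aux_int_exp {d : ℕ} {b : ℝ} (hb : 0 < b) :
    Integrable (fun z : EuclideanSpace ℝ (Fin d) => Real.exp (-b * ‖z‖ ^ 2)) := by
  have h := integral_undef (μ := volume)
    (f := fun z : EuclideanSpace ℝ (Fin d) => Real.exp (-b * ‖z‖ ^ 2))
  by_contra hc
  have h1 := h hc
  rw [GaussianFourier.integral_rexp_neg_mul_sq_norm hb] at h1
  have : 0 < (Real.pi / b) ^ ((Module.finrank ℝ (EuclideanSpace ℝ (Fin d)) : ℝ) / 2) := by
    have := Real.pi_pos
    positivity
  linarith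

lemma aux_int_gauss {d : ℕ} {s : ℝ} (hs : 0 < s) :
    Integrable (fun z : EuclideanSpace ℝ (Fin d) => gaussDensity 0 s z) := by
  have h := (aux_int_exp (d := d) (b := 1 / (2 * s)) (by positivity)).const_mul
    ((2 * Real.pi * s) ^ (-(d : ℝ) / 2))
  refine h.congr (Filter.Eventually.of_forall fun z => ?_)
  simp only [gaussDensity, sub_zero]
  congr 2
  ring

lemma aux_gauss_one {d : ℕ} {s : ℝ} (hs : 0 < s) :
    ∫ z : EuclideanSpace ℝ (Fin d), gaussDensity 0 s z = 1 := by
  have h := GaussianFourier.integral_rexp_neg_mul_sq_norm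
    (V := EuclideanSpace ℝ (Fin d)) (b := 1 / (2 * s)) (by positivity)
  have e : ∀ z : EuclideanSpace ℝ (Fin d), gaussDensity 0 s z =
      (2 * Real.pi * s) ^ (-(d : ℝ) / 2) * Real.exp (-(1 / (2 * s)) * ‖z‖ ^ 2) := by
    intro z
    simp only [gaussDensity, sub_zero]
    congr 2
    ring
  simp_rw [e]
  rw [integral_const_mul, h, finrank_euclideanSpace_fin]
  have hp := Real.pi_pos
  have : Real.pi / (1 / (2 * s)) = 2 * Real.pi * s := by field_simp
  rw [this, ← Real.rpow_add (by positivity)]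
  have : -(d : ℝ) / 2 + (d : ℝ) / 2 = 0 := by ring
  rw [this, Real.rpow_zero]

lemma aux_gauss_nonneg {d : ℕ} {s : ℝ} (hs : 0 < s) (m z : EuclideanSpace ℝ (Fin d)) :
    0 < gaussDensity m s z := by
  have hp := Real.pi_pos
  unfold gaussDensity
  positivity

lemma aux_gauss_cont {d : ℕ} {s : ℝ} :
    Continuous (fun z : EuclideanSpace ℝ (Fin d) => gaussDensity 0 s z) := by
  unfold gaussDensity
  fun_prop

lemma aux_int_gauss_sq {d : ℕ} {s : ℝ} (hs : 0 < s) :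
    Integrable (fun z : EuclideanSpace ℝ (Fin d) => gaussDensity 0 s z * ‖z‖ ^ 2) := by
  have h := (aux_int_exp (d := d) (b := 1 / (4 * s)) (by positivity)).const_mul
    ((2 * Real.pi * s) ^ (-(d : ℝ) / 2) * (4 * s))
  refine h.mono' (aux_gauss_cont.mul (by fun_prop)).aestronglyMeasurable
    (Filter.Eventually.of_forall fun z => ?_)
  have hp := Real.pi_pos
  rw [Real.norm_of_nonneg (mul_nonneg (aux_gauss_nonneg hs 0 z).le (sq_nonneg ‖z‖))]
  simp only [gaussDensity, sub_zero]
  have hC : 0 ≤ (2 * Real.pi * s) ^ (-(d : ℝ) / 2) := by positivity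
  generalize (2 * Real.pi * s) ^ (-(d : ℝ) / 2) = C at hC ⊢
  rw [mul_assoc C, mul_assoc C]
  refine mul_le_mul_of_nonneg_left ?_ hC
  have h1 : ‖z‖ ^ 2 / (4 * s) ≤ Real.exp (‖z‖ ^ 2 / (4 * s)) := by
    have := Real.add_one_le_exp (‖z‖ ^ 2 / (4 * s))
    linarith
  have h2 : -‖z‖ ^ 2 / (2 * s) = -(1 / (4 * s)) * ‖z‖ ^ 2 + -(‖z‖ ^ 2 / (4 * s)) := by
    field_simp; ring
  rw [h2, Real.exp_add, mul_assoc, mul_comm (4 * s) (Real.exp _)]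
  refine mul_le_mul_of_nonneg_left ?_ (Real.exp_nonneg _)
  rw [Real.exp_neg, inv_mul_le_iff₀ (Real.exp_pos _)]
  rwa [div_le_iff₀ (by positivity)] at h1

lemma aux_inner_abs {E : Type*} [NormedAddCommGroup E] [InnerProductSpace ℝ E] (z w : E) :
    |2 * inner ℝ z w + ‖w‖ ^ 2| ≤ ‖z‖ ^ 2 + 2 * ‖w‖ ^ 2 := by
  have h1 := abs_real_inner_le_norm z w
  rw [abs_le] at h1 ⊢
  constructor <;> nlinarith [sq_nonneg (‖z‖ - ‖w‖), sq_nonneg ‖w‖]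

lemma aux_inner_integral {d : ℕ} {s : ℝ} (hs : 0 < s) (w : EuclideanSpace ℝ (Fin d)) :
    ∫ z : EuclideanSpace ℝ (Fin d), gaussDensity 0 s z * (2 * inner ℝ z w + ‖w‖ ^ 2)
      = ‖w‖ ^ 2 := by
  have hi : Integrable (fun z : EuclideanSpace ℝ (Fin d) =>
      gaussDensity 0 s z * (2 * inner ℝ z w + ‖w‖ ^ 2)) := by
    refine ((aux_int_gauss_sq hs).add ((aux_int_gauss hs).mul_const (2 * ‖w‖ ^ 2))).mono'
      (aux_gauss_cont.mul (by fun_prop)).aestronglyMeasurable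
      (Filter.Eventually.of_forall fun z => ?_)
    rw [norm_mul, Real.norm_of_nonneg (aux_gauss_nonneg hs 0 z).le, Real.norm_eq_abs]
    simp only [Pi.add_apply]
    rw [← mul_add]
    exact mul_le_mul_of_nonneg_left (aux_inner_abs z w) (aux_gauss_nonneg hs 0 z).le
  have hc := (aux_int_gauss (d := d) hs).mul_const (‖w‖ ^ 2)
  have h1 : ∫ z : EuclideanSpace ℝ (Fin d), gaussDensity 0 s z * (2 * inner ℝ z w) = 0 := by
    have h := integral_neg_eq_self
      (fun z : EuclideanSpace ℝ (Fin d) => gaussDensity 0 s z * (2 * inner ℝ z w)) volume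
    have e : ∀ z : EuclideanSpace ℝ (Fin d), gaussDensity 0 s (-z) * (2 * inner ℝ (-z) w)
        = -(gaussDensity 0 s z * (2 * inner ℝ z w)) := by
      intro z
      simp [gaussDensity, inner_neg_left]
    simp_rw [e] at h
    rw [integral_neg] at h
    linarith
  have h2 := hi.sub hc
  have e2 : ∀ z : EuclideanSpace ℝ (Fin d),
      gaussDensity 0 s z * (2 * inner ℝ z w + ‖w‖ ^ 2)
      = gaussDensity 0 s z * (2 * inner ℝ z w) + gaussDensity 0 s z * ‖w‖ ^ 2 :=
    fun z => mul_add _ _ _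
  have hi1 : Integrable (fun z : EuclideanSpace ℝ (Fin d) =>
      gaussDensity 0 s z * (2 * inner ℝ z w)) := by
    refine h2.congr (Filter.Eventually.of_forall fun z => ?_)
    simp only [Pi.sub_apply, e2]
    ring
  simp_rw [e2]
  rw [integral_add hi1 hc, h1, integral_mul_const, aux_gauss_one hs]
  ring

lemma aux_prod {d : ℕ} {s : ℝ} (hs : 0 < s) (P : EuclideanSpace ℝ (Fin d) → ℝ)
    (hPmeas : Measurable P) (hPnonneg : ∀ x, 0 ≤ P x) (hPi : Integrable P)
    (w : EuclideanSpace ℝ (Fin d) → EuclideanSpace ℝ (Fin d)) (hw : Measurable w)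
    (hint : Integrable (fun x => ‖w x‖ ^ 2 * P x)) :
    ∫ q : EuclideanSpace ℝ (Fin d) × EuclideanSpace ℝ (Fin d),
      P q.1 * (gaussDensity 0 s q.2 * (2 * inner ℝ q.2 (w q.1) + ‖w q.1‖ ^ 2))
      = ∫ x, ‖w x‖ ^ 2 * P x := by
  have hgm : Measurable (fun z : EuclideanSpace ℝ (Fin d) => gaussDensity 0 s z) :=
    aux_gauss_cont.measurable
  have hi : Integrable (fun q : EuclideanSpace ℝ (Fin d) × EuclideanSpace ℝ (Fin d) =>
      P q.1 * (gaussDensity 0 s q.2 * (2 * inner ℝ q.2 (w q.1) + ‖w q.1‖ ^ 2)))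
      (volume.prod volume) := by
    have ha := hPi.mul_prod (aux_int_gauss_sq (d := d) hs)
    have hb := (hint.mul_prod (aux_int_gauss (d := d) hs)).const_mul 2
    refine (ha.add hb).mono' ?_ (Filter.Eventually.of_forall fun q => ?_)
    · have : Measurable (fun q : EuclideanSpace ℝ (Fin d) × EuclideanSpace ℝ (Fin d) =>
        gaussDensity 0 s q.2) := hgm.comp measurable_snd
      refine Measurable.aestronglyMeasurable ?_
      fun_prop
    · rw [norm_mul, norm_mul, Real.norm_of_nonneg (aux_gauss_nonneg hs 0 q.2).le,
        Real.norm_of_nonneg (hPnonneg _), Real.norm_eq_abs]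
      simp only [Pi.add_apply]
      have := mul_le_mul_of_nonneg_left (aux_inner_abs q.2 (w q.1))
        (mul_nonneg (hPnonneg q.1) (aux_gauss_nonneg hs 0 q.2).le)
      linarith
  rw [Measure.volume_eq_prod, integral_prod _ hi]
  simp only [integral_const_mul, aux_inner_integral hs]
  simp_rw [mul_comm]

lemma aux_KL {d : ℕ} {s : ℝ} (hs : 0 < s) (P : EuclideanSpace ℝ (Fin d) → ℝ)
    (hPmeas : Measurable P) (hPnonneg : ∀ x, 0 ≤ P x) (hPi : Integrable P)
    (m m' : EuclideanSpace ℝ (Fin d) → EuclideanSpace ℝ (Fin d)) (hm : Measurable m)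
    (hm' : Measurable m')
    (hint : Integrable (fun x => ‖m x - m' x‖ ^ 2 * P x)) :
    KL volume (fun p : EuclideanSpace ℝ (Fin d) × EuclideanSpace ℝ (Fin d) =>
        gaussDensity (m p.2) s p.1 * P p.2) (fun p => gaussDensity (m' p.2) s p.1 * P p.2)
      = (1 / (2 * s)) * ∫ x, ‖m x - m' x‖ ^ 2 * P x := by
  have hgm : Measurable (fun z : EuclideanSpace ℝ (Fin d) => gaussDensity 0 s z) :=
    aux_gauss_cont.measurable
  have hmp : MeasurePreserving
      (fun p : EuclideanSpace ℝ (Fin d) × EuclideanSpace ℝ (Fin d) => (p.2, p.1 - m p.2))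
      (volume.prod volume) (volume.prod volume) := by
    have h1 : MeasurePreserving
      (fun p : EuclideanSpace ℝ (Fin d) × EuclideanSpace ℝ (Fin d) => (p.1, p.2 - m p.1))
      (volume.prod volume) (volume.prod volume) := by
      refine MeasurePreserving.skew_product (g := fun x y => y - m x)
        (MeasurePreserving.id volume) (by unfold Function.uncurry; fun_prop)
        (Filter.Eventually.of_forall fun x => ?_)
      exact (measurePreserving_sub_right volume (m x)).map_eq
    exact h1.comp Measure.measurePreserving_swap
  rw [← aux_prod hs P hPmeas hPnonneg hPi (fun x => m x - m' x) (by fun_prop) hint]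
  rw [Measure.volume_eq_prod, ← hmp.map_eq, integral_map hmp.measurable.aemeasurable,
    hmp.map_eq, ← integral_const_mul]
  · unfold KL
    refine integral_congr_ae (Filter.Eventually.of_forall fun p => ?_)
    simp only
    rcases (hPnonneg p.2).eq_or_lt with h0 | h0
    · simp [← h0]
    have hp := Real.pi_pos
    have hr : gaussDensity (m p.2) s p.1 * P p.2 / (gaussDensity (m' p.2) s p.1 * P p.2)
        = Real.exp ((2 * inner ℝ (p.1 - m p.2) (m p.2 - m' p.2) + ‖m p.2 - m' p.2‖ ^ 2)
          / (2 * s)) := by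
      rw [mul_div_mul_right _ _ h0.ne']
      unfold gaussDensity
      rw [mul_div_mul_left _ _ (by positivity), ← Real.exp_sub]
      congr 1
      have e : p.1 - m' p.2 = (p.1 - m p.2) + (m p.2 - m' p.2) := by abel
      rw [e, norm_add_sq_real]
      ring
    rw [hr, Real.log_exp]
    have : gaussDensity (m p.2) s p.1 = gaussDensity 0 s (p.1 - m p.2) := by
      simp [gaussDensity]
    rw [this]
    ring
  · have : Measurable (fun q : EuclideanSpace ℝ (Fin d) × EuclideanSpace ℝ (Fin d) =>
        gaussDensity 0 s q.2) := hgm.comp measurable_snd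
    refine Measurable.aestronglyMeasurable ?_
    fun_prop

/-- **Entropy production rate as a Fisher-type divergence along interpolated dynamics.**
Let `ℙ^θ(y,x) = g^θ(y|x) P(x)` where `g^θ(·|x)` is Gaussian with mean
`x + μF(x)·dt − 2θν(x)·dt` and covariance `2μT·dt·Id`, and let
`σ = (1/(μT)) ∫ ‖ν‖² P dx`. Then for all `θ, θ' ∈ [0,1]`,
`D_KL(ℙ^θ‖ℙ^{θ'}) = (θ−θ')²·dt·σ`; in particular, for `θ ≠ θ'`,
`σ = D_KL(ℙ^θ‖ℙ^{θ'})/((θ−θ')² dt)`. -/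
theorem entropy_production_rate_eq_kl_interpolated {d : ℕ} (μ T dt : ℝ)
    (hμ : 0 < μ) (hT : 0 < T) (hdt : 0 < dt)
    (P : EuclideanSpace ℝ (Fin d) → ℝ)
    (hPmeas : Measurable P) (hPnonneg : ∀ x, 0 ≤ P x) (hPone : (∫ x, P x) = 1)
    (F ν : EuclideanSpace ℝ (Fin d) → EuclideanSpace ℝ (Fin d))
    (hF : Measurable F) (hν : Measurable ν)
    (hint : Integrable (fun x => ‖ν x‖ ^ 2 * P x))
    (σ : ℝ) (hσ : σ = (1 / (μ * T)) * ∫ x, ‖ν x‖ ^ 2 * P x)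
    (Pjoint : ℝ → (EuclideanSpace ℝ (Fin d) × EuclideanSpace ℝ (Fin d) → ℝ))
    (hPjoint : ∀ θ p, Pjoint θ p =
      gaussDensity (p.2 + (μ * dt) • F p.2 - (2 * θ * dt) • ν p.2) (2 * μ * T * dt) p.1
        * P p.2) :
    (∀ θ ∈ Set.Icc (0 : ℝ) 1, ∀ θ' ∈ Set.Icc (0 : ℝ) 1,
        KL volume (Pjoint θ) (Pjoint θ') = (θ - θ') ^ 2 * dt * σ) ∧
      (∀ θ ∈ Set.Icc (0 : ℝ) 1, ∀ θ' ∈ Set.Icc (0 : ℝ) 1, θ ≠ θ' →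
        σ = KL volume (Pjoint θ) (Pjoint θ') / ((θ - θ') ^ 2 * dt)) := by
  have hPi : Integrable P := by
    by_contra hc
    rw [integral_undef hc] at hPone
    exact zero_ne_one hPone
  have hs : 0 < 2 * μ * T * dt := by positivity
  have key : ∀ θ θ' : ℝ, KL volume (Pjoint θ) (Pjoint θ') = (θ - θ') ^ 2 * dt * σ := by
    intro θ θ'
    have e : ∀ x, ‖(x + (μ * dt) • F x - (2 * θ * dt) • ν x)
        - (x + (μ * dt) • F x - (2 * θ' * dt) • ν x)‖ ^ 2 * P x
        = (4 * (θ - θ') ^ 2 * dt ^ 2) * (‖ν x‖ ^ 2 * P x) := by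
      intro x
      have : (x + (μ * dt) • F x - (2 * θ * dt) • ν x)
        - (x + (μ * dt) • F x - (2 * θ' * dt) • ν x) = (-(2 * (θ - θ') * dt)) • ν x := by
        module
      rw [this, norm_smul, mul_pow, Real.norm_eq_abs, sq_abs]
      ring
    have h := aux_KL hs P hPmeas hPnonneg hPi
      (fun x => x + (μ * dt) • F x - (2 * θ * dt) • ν x)
      (fun x => x + (μ * dt) • F x - (2 * θ' * dt) • ν x) (by fun_prop) (by fun_prop)
      (by simp only [e]; exact hint.const_mul _)
    rw [funext (hPjoint θ), funext (hPjoint θ'), h]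
    simp only [e]
    rw [integral_const_mul, hσ]
    field_simp
    ring
  refine ⟨fun θ _ θ' _ => key θ θ', fun θ _ θ' _ hne => ?_⟩
  rw [key]
  have : θ - θ' ≠ 0 := sub_ne_zero.mpr hne
  field_simp
end

section
/- Let μ, T > 0, let P : ℝ^d → ℝ be a smooth probability density, let ν : ℝ^d → ℝ^d be a smooth vector field, and let φ : ℝ^d → ℝ be smooth with ν* := ∇φ. Assume the zero-divergence condition ∇·((ν − ν*)·P) = 0 holds on ℝ^d, and that φ·(ν − ν*)·P has compact support (so that the boundary term in integration by parts vanishes), with ∫‖ν‖²P dx and ∫‖ν*‖²P dx finite. Then the orthogonality ∫ ⟨ν*(x), ν(x) − ν*(x)⟩ P(x) dx = 0 holds, and consequently the entropy production rate decomposes as σ = σ^ex + σ^hk, where σ = (1/(μT))∫‖ν‖²P dx, σ^ex = (1/(μT))∫‖ν*‖²P dx, and σ^hk = (1/(μT))∫‖ν − ν*‖²P dx. -/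
open MeasureTheory
open scoped RealInnerProductSpace

/-- Divergence of a vector field on `ℝ^d`: `∇·u (x) = ∑ᵢ ∂ᵢ uᵢ(x)`. -/
noncomputable def diverg {d : ℕ}
    (u : EuclideanSpace ℝ (Fin d) → EuclideanSpace ℝ (Fin d))
    (x : EuclideanSpace ℝ (Fin d)) : ℝ :=
  ∑ i, fderiv ℝ (fun y => u y i) x (EuclideanSpace.single i 1)

/-- **Geometric decomposition of the entropy production rate.**
Let `ν* = ∇φ` with `∇·((ν − ν*)P) = 0` and `φ(ν − ν*)P` compactly supported. Then
`∫⟨ν*, ν − ν*⟩P dx = 0` and consequently `σ = σ^ex + σ^hk`, where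
`σ = (1/(μT))∫‖ν‖²P`, `σ^ex = (1/(μT))∫‖ν*‖²P`, `σ^hk = (1/(μT))∫‖ν − ν*‖²P`. -/
theorem entropy_production_decomposition {d : ℕ} (μ T : ℝ)
    (hμ : 0 < μ) (hT : 0 < T)
    (P : EuclideanSpace ℝ (Fin d) → ℝ)
    (hP : ContDiff ℝ (⊤ : ℕ∞) P) (hPnonneg : ∀ x, 0 ≤ P x) (hPone : (∫ x, P x) = 1)
    (ν : EuclideanSpace ℝ (Fin d) → EuclideanSpace ℝ (Fin d))
    (hν : ContDiff ℝ (⊤ : ℕ∞) ν)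
    (φ : EuclideanSpace ℝ (Fin d) → ℝ) (hφ : ContDiff ℝ (⊤ : ℕ∞) φ)
    (νstar : EuclideanSpace ℝ (Fin d) → EuclideanSpace ℝ (Fin d))
    (hνstar : ∀ x, νstar x = gradient φ x)
    (hzerodiv : ∀ x, diverg (fun y => P y • (ν y - νstar y)) x = 0)
    (hsupp : HasCompactSupport (fun x => φ x • (P x • (ν x - νstar x))))
    (hν2 : Integrable (fun x => ‖ν x‖ ^ 2 * P x))
    (hνstar2 : Integrable (fun x => ‖νstar x‖ ^ 2 * P x))
    (σ σex σhk : ℝ)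
    (hσ : σ = (1 / (μ * T)) * ∫ x, ‖ν x‖ ^ 2 * P x)
    (hσex : σex = (1 / (μ * T)) * ∫ x, ‖νstar x‖ ^ 2 * P x)
    (hσhk : σhk = (1 / (μ * T)) * ∫ x, ‖ν x - νstar x‖ ^ 2 * P x) :
    (∫ x, ⟪νstar x, ν x - νstar x⟫ * P x) = 0 ∧ σ = σex + σhk := by
  have hns : νstar = fun x => (InnerProductSpace.toDual ℝ _).symm (fderiv ℝ φ x) := by
    funext x; rw [hνstar x]; rfl
  have hnsC : ContDiff ℝ (⊤ : ℕ∞) νstar := by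
    rw [hns]
    exact (InnerProductSpace.toDual ℝ
      (EuclideanSpace ℝ (Fin d))).symm.contDiff.comp (hφ.fderiv_right (by simp))
  set W : EuclideanSpace ℝ (Fin d) → EuclideanSpace ℝ (Fin d) :=
    fun x => P x • (ν x - νstar x) with hW
  have hWC : ContDiff ℝ (⊤ : ℕ∞) W := hP.smul (hν.sub hnsC)
  have hWi : ∀ i, ContDiff ℝ (⊤ : ℕ∞) (fun x => W x i) := fun i =>
    (contDiff_euclidean.1 hWC) i
  have hFi : ∀ i, ContDiff ℝ (⊤ : ℕ∞) (fun x => φ x * W x i) := fun i => hφ.mul (hWi i)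
  have hcs : ∀ i, HasCompactSupport (fun x => φ x * W x i) := fun i =>
    hsupp.comp_left (g := fun v : EuclideanSpace ℝ (Fin d) => v i) rfl
  have hDerivInt : ∀ i, Integrable
      (fun x => fderiv ℝ (fun x => φ x * W x i) x (EuclideanSpace.single i 1)) := fun i => by
    refine Continuous.integrable_of_hasCompactSupport ?_ ?_
    · exact ((hFi i).continuous_fderiv (by simp)).clm_apply continuous_const
    · exact (hcs i).fderiv_apply ℝ _
  have hzero : ∀ i, ∫ x, fderiv ℝ (fun x => φ x * W x i) x (EuclideanSpace.single i 1) = 0 :=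
      fun i => by
    have := integral_mul_fderiv_eq_neg_fderiv_mul_of_integrable (𝕜 := ℝ)
      (μ := (volume : Measure (EuclideanSpace ℝ (Fin d))))
      (f := fun _ => (1 : ℝ)) (g := fun x => φ x * W x i) (v := EuclideanSpace.single i 1)
      (by simp) (by simpa using hDerivInt i)
      (by simpa using (hFi i).continuous.integrable_of_hasCompactSupport (hcs i))
      (fun x _ => differentiableAt_const _) (fun x _ => (hFi i).differentiable (by simp) x)
    simpa using this
  have key : ∀ x, ⟪νstar x, ν x - νstar x⟫ * P x
      = ∑ i, fderiv ℝ (fun x => φ x * W x i) x (EuclideanSpace.single i 1) := fun x => by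
    have h1 : ∀ i, fderiv ℝ (fun x => φ x * W x i) x (EuclideanSpace.single i 1)
        = φ x * fderiv ℝ (fun x => W x i) x (EuclideanSpace.single i 1)
          + W x i * fderiv ℝ φ x (EuclideanSpace.single i 1) := fun i => by
      rw [fderiv_fun_mul (hφ.differentiable (by simp) x) ((hWi i).differentiable (by simp) x)]
      simp
    have h2 : fderiv ℝ φ x (W x) = ∑ i, W x i * fderiv ℝ φ x (EuclideanSpace.single i 1) := by
      conv_lhs => rw [← (EuclideanSpace.basisFun (Fin d) ℝ).sum_repr (W x)]
      simp
    have h3 := hzerodiv x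
    unfold diverg at h3
    simp only [h1, Finset.sum_add_distrib, ← Finset.mul_sum]
    rw [h3, ← h2, hns]
    simp [hW, hns, mul_comm]
  have hI : Integrable (fun x => ⟪νstar x, ν x - νstar x⟫ * P x) := by
    simp only [key]
    exact integrable_finsetSum _ fun i _ => hDerivInt i
  have hO : (∫ x, ⟪νstar x, ν x - νstar x⟫ * P x) = 0 := by
    simp only [key]
    rw [integral_finsetSum _ fun i _ => hDerivInt i]
    simp [hzero]
  refine ⟨hO, ?_⟩
  have hhk : (fun x => ‖ν x - νstar x‖ ^ 2 * P x) = fun x =>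
      ‖ν x‖ ^ 2 * P x - ‖νstar x‖ ^ 2 * P x - 2 * (⟪νstar x, ν x - νstar x⟫ * P x) := by
    funext x
    have := norm_add_sq_real (νstar x) (ν x - νstar x)
    rw [add_sub_cancel] at this
    rw [this]; ring
  have hsub : Integrable (fun x => ‖ν x‖ ^ 2 * P x - ‖νstar x‖ ^ 2 * P x) := hν2.sub hνstar2
  rw [hσ, hσex, hσhk, hhk, integral_sub hsub (hI.const_mul 2),
    integral_sub hν2 hνstar2, integral_const_mul, hO]
  ring
end

section
/- Let μ, T > 0, let P : ℝ^d → ℝ be a smooth probability density, let φ : ℝ^d → ℝ be smooth with ν* := ∇φ, and let q : ℝ^d → ℝ be the smooth function q = −∇·(ν*·P) (representing ∂_τ P_τ under the continuity equation). Let r : ℝ^d → ℝ be smooth such that r·ν*·P has compact support, with ∫‖∇r‖²P dx ∈ (0,∞) and ∫‖ν*‖²P dx < ∞. Define the excess entropy production rate σ^ex = (1/(μT))∫‖ν*‖²P dx. Then ∫ r(x) q(x) dx = ∫ ⟨ν*(x), ∇r(x)⟩ P(x) dx, and the thermodynamic uncertainty relation for the excess entropy production rate holds: σ^ex ≥ (∫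 r q dx)² / (μT · ∫ ‖∇r‖² P dx). -/
open MeasureTheory
open scoped RealInnerProductSpace

/-- **Thermodynamic uncertainty relation for the excess entropy production rate.**
Let `ν* = ∇φ` be the optimal mean local velocity and `q = −∇·(ν*P)` (representing
`∂_τ P_τ`). For a smooth observable `r` with `r·ν*·P` compactly supported, one has
`∫ r q dx = ∫ ⟨ν*, ∇r⟩ P dx` and
`σ^ex ≥ (∫ r q dx)²/(μT·∫‖∇r‖²P dx)` where `σ^ex = (1/(μT))∫‖ν*‖²P dx`. -/
theorem tur_excess_entropy_production {d : ℕ} (μ T : ℝ)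
    (hμ : 0 < μ) (hT : 0 < T)
    (P : EuclideanSpace ℝ (Fin d) → ℝ)
    (hP : ContDiff ℝ (⊤ : ℕ∞) P) (hPnonneg : ∀ x, 0 ≤ P x) (hPone : (∫ x, P x) = 1)
    (φ : EuclideanSpace ℝ (Fin d) → ℝ) (hφ : ContDiff ℝ (⊤ : ℕ∞) φ)
    (νstar : EuclideanSpace ℝ (Fin d) → EuclideanSpace ℝ (Fin d))
    (hνstar : ∀ x, νstar x = gradient φ x)
    (q : EuclideanSpace ℝ (Fin d) → ℝ)
    (hq : ∀ x, q x = - diverg (fun y => P y • νstar y) x)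
    (r : EuclideanSpace ℝ (Fin d) → ℝ) (hr : ContDiff ℝ (⊤ : ℕ∞) r)
    (hsupp : HasCompactSupport (fun x => r x • (P x • νstar x)))
    (hgradr2 : Integrable (fun x => ‖gradient r x‖ ^ 2 * P x))
    (hgradr2pos : 0 < ∫ x, ‖gradient r x‖ ^ 2 * P x)
    (hνstar2 : Integrable (fun x => ‖νstar x‖ ^ 2 * P x))
    (σex : ℝ) (hσex : σex = (1 / (μ * T)) * ∫ x, ‖νstar x‖ ^ 2 * P x) :
    (∫ x, r x * q x) = (∫ x, ⟪νstar x, gradient r x⟫ * P x) ∧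
      σex ≥ (∫ x, r x * q x) ^ 2 / (μ * T * ∫ x, ‖gradient r x‖ ^ 2 * P x) := by
  have hν : ContDiff ℝ 1 νstar := by
    have h1 : ContDiff ℝ 1 (fderiv ℝ φ) := hφ.fderiv_right (by norm_cast)
    have h2 : νstar = fun x => (InnerProductSpace.toDual ℝ _).symm (fderiv ℝ φ x) := by
      funext x; rw [hνstar x]; rfl
    rw [h2]
    exact (InnerProductSpace.toDual ℝ (EuclideanSpace ℝ (Fin d))).symm.contDiff.comp h1
  have hr1 : ContDiff ℝ 1 r := hr.of_le (by norm_cast)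
  have hP1 : ContDiff ℝ 1 P := hP.of_le (by norm_cast)
  have hgr : Continuous (gradient r) := by
    have h1 : Continuous (fderiv ℝ r) := hr1.continuous_fderiv (by norm_num)
    exact (InnerProductSpace.toDual ℝ (EuclideanSpace ℝ (Fin d))).symm.continuous.comp h1
  have hu : ∀ i, ContDiff ℝ 1 (fun y => (P y • νstar y) i) := fun i => by
    have := hP1.smul hν
    exact (contDiff_euclidean.1 this) i
  have hw : ∀ i, ContDiff ℝ 1 (fun y => r y * (P y • νstar y) i) := fun i => hr1.mul (hu i)
  have hws : ∀ i, HasCompactSupport (fun y => r y * (P y • νstar y) i) := fun i =>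
    hsupp.comp_left (g := fun v : EuclideanSpace ℝ (Fin d) => v i) rfl
  have hws' : ∀ i, HasCompactSupport (fun x =>
      fderiv ℝ (fun y => r y * (P y • νstar y) i) x (EuclideanSpace.single i 1)) := fun i =>
    ((hws i).fderiv (𝕜 := ℝ)).comp_left
      (g := fun L : EuclideanSpace ℝ (Fin d) →L[ℝ] ℝ => L (EuclideanSpace.single i 1)) rfl
  have hwi : ∀ i, Integrable (fun x =>
      fderiv ℝ (fun y => r y * (P y • νstar y) i) x (EuclideanSpace.single i 1)) := fun i =>
    (((hw i).continuous_fderiv (by norm_num)).clm_apply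
      continuous_const).integrable_of_hasCompactSupport (hws' i)
  have hw0 : ∀ i, ∫ x,
      fderiv ℝ (fun y => r y * (P y • νstar y) i) x (EuclideanSpace.single i 1) = 0 := fun i => by
    have := integral_mul_fderiv_eq_neg_fderiv_mul_of_integrable
      (μ := (volume : Measure (EuclideanSpace ℝ (Fin d)))) (𝕜 := ℝ)
      (f := fun _ => (1 : ℝ)) (g := fun y => r y * (P y • νstar y) i)
      (v := EuclideanSpace.single i 1) (by simp) (by simpa using hwi i)
      (by simpa using (hw i).continuous.integrable_of_hasCompactSupport (hws i))
      (fun x _ => by fun_prop) (fun x _ => (hw i).differentiable (by norm_num) x)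
    simpa using this
  have hCi : Integrable (fun x => ⟪νstar x, gradient r x⟫ * P x) := by
    refine (hgradr2.add hνstar2).mono'
      ((hν.continuous.inner hgr).mul hP.continuous).aestronglyMeasurable
      (Filter.Eventually.of_forall fun x => ?_)
    have h1 := abs_real_inner_le_norm (νstar x) (gradient r x)
    simp only [Pi.add_apply, norm_mul, Real.norm_eq_abs, abs_of_nonneg (hPnonneg x), ← add_mul]
    refine mul_le_mul_of_nonneg_right ?_ (hPnonneg x)
    nlinarith [sq_nonneg (‖νstar x‖ - ‖gradient r x‖), sq_nonneg ‖νstar x‖,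
      sq_nonneg ‖gradient r x‖]
  have hgi : ∀ x i, fderiv ℝ r x (EuclideanSpace.single i 1) = gradient r x i := fun x i => by
    have : ⟪gradient r x, EuclideanSpace.single i (1 : ℝ)⟫ =
        fderiv ℝ r x (EuclideanSpace.single i 1) := by
      simp [gradient]
    rw [← this, EuclideanSpace.inner_single_right]
    simp
  have hpt : ∀ x, r x * q x = ⟪νstar x, gradient r x⟫ * P x -
      ∑ i, fderiv ℝ (fun y => r y * (P y • νstar y) i) x (EuclideanSpace.single i 1) := fun x => by
    have h1 : ∀ i, fderiv ℝ (fun y => r y * (P y • νstar y) i) x (EuclideanSpace.single i 1)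
        = r x * fderiv ℝ (fun y => (P y • νstar y) i) x (EuclideanSpace.single i 1)
          + gradient r x i * νstar x i * P x := fun i => by
      rw [fderiv_fun_mul ((hr1.differentiable (by norm_num)) x)
        (((hu i).differentiable (by norm_num)) x)]
      simp only [add_apply, smul_apply, hgi, smul_eq_mul,
        PiLp.smul_apply]
      ring
    simp only [h1, Finset.sum_add_distrib, ← Finset.mul_sum, ← Finset.sum_mul, hq, diverg]
    rw [PiLp.inner_apply]
    simp
  have hfirst : (∫ x, r x * q x) = (∫ x, ⟪νstar x, gradient r x⟫ * P x) := by
    simp only [hpt]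
    rw [integral_sub hCi (integrable_finsetSum _ fun i _ => hwi i),
      integral_finsetSum _ fun i _ => hwi i]
    simp only [hw0, Finset.sum_const_zero, sub_zero]
  refine ⟨hfirst, ?_⟩
  rw [hfirst, hσex]
  set A := ∫ x, ‖νstar x‖ ^ 2 * P x with hA
  set B := ∫ x, ‖gradient r x‖ ^ 2 * P x with hB
  set C := ∫ x, ⟪νstar x, gradient r x⟫ * P x with hC
  have hquad : ∀ t : ℝ, 0 ≤ A - 2 * t * C + t ^ 2 * B := fun t => by
    have h0 : 0 ≤ ∫ x, ‖νstar x - t • gradient r x‖ ^ 2 * P x :=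
      integral_nonneg fun x => mul_nonneg (sq_nonneg _) (hPnonneg x)
    have h1 : ∀ x, ‖νstar x - t • gradient r x‖ ^ 2 * P x = ‖νstar x‖ ^ 2 * P x
        - 2 * t * (⟪νstar x, gradient r x⟫ * P x) + t ^ 2 * (‖gradient r x‖ ^ 2 * P x) := fun x => by
      rw [norm_sub_sq_real, real_inner_smul_right, norm_smul, mul_pow, Real.norm_eq_abs, sq_abs]
      ring
    simp only [h1] at h0
    have h2 : Integrable (fun x => ‖νstar x‖ ^ 2 * P x
        - 2 * t * (⟪νstar x, gradient r x⟫ * P x)) := hνstar2.sub (hCi.const_mul _)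
    rw [integral_add h2 (hgradr2.const_mul _),
      integral_sub hνstar2 (hCi.const_mul _), integral_const_mul, integral_const_mul] at h0
    exact h0
  have hcs : C ^ 2 / B ≤ A := by
    have h := hquad (C / B)
    have : A - 2 * (C / B) * C + (C / B) ^ 2 * B = A - C ^ 2 / B := by
      field_simp
      ring
    linarith
  have hμT : 0 < μ * T := mul_pos hμ hT
  have : C ^ 2 / (μ * T * B) = 1 / (μ * T) * (C ^ 2 / B) := by
    field_simp
  rw [ge_iff_le, this]
  exact mul_le_mul_of_nonneg_left hcs (by positivity)
end

section
/- Let μ, T > 0, let P : ℝ^d → ℝ be a smooth strictly positive probability density, and let φ : ℝ^d → ℝ be smooth, with pseudo energy U* = (−φ − μT·log P)/μ, Z := ∫ exp(−U*/T) dx ∈ (0,∞), and pseudo canonical distribution P^pcan = exp(−U*/T)/Z. Let q = −∇·((∇φ)·P) (representing ∂_τ P_τ under the optimal continuity equation). Assume φ·(∇φ)·P and log(P/P^pcan)·(∇φ)·P have compact support, ∫ q dx = 0, and ∫‖∇φ‖²P dx < ∞. Then the excess entropy production rate satisfies σ^ex := (1/(μT)) ∫ ‖∇φ(x)‖² P(x)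 dx = −∫ q(x) · log( P(x)/P^pcan(x) ) dx; i.e., σ^ex equals minus the time derivative of the KL divergence D_KL(P_τ ‖ P^pcan_s) with respect to τ at s = τ. -/
open MeasureTheory

/-- The integral of a directional derivative of a compactly supported `C¹` function vanishes. -/
lemma integral_fderiv_compact_zero {d : ℕ} (f : EuclideanSpace ℝ (Fin d) → ℝ)
    (hf : ContDiff ℝ 1 f) (hs : HasCompactSupport f) (v : EuclideanSpace ℝ (Fin d)) :
    Integrable (fun x => fderiv ℝ f x v) ∧ (∫ x, fderiv ℝ f x v) = 0 := by
  have hint : Integrable (fun x => fderiv ℝ f x v) := by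
    apply Continuous.integrable_of_hasCompactSupport
    · exact (hf.continuous_fderiv one_ne_zero).clm_apply continuous_const
    · exact hs.fderiv_apply ℝ v
  refine ⟨hint, ?_⟩
  have h := integral_mul_fderiv_eq_neg_fderiv_mul_of_integrable
    (μ := (volume : Measure (EuclideanSpace ℝ (Fin d)))) (𝕜 := ℝ)
    (f := fun _ => (1 : ℝ)) (g := f) (v := v) (by simp) (by simpa using hint)
    (by simpa using hf.continuous.integrable_of_hasCompactSupport hs)
    (by fun_prop) (fun x _ => (hf.differentiable one_ne_zero) x)
  simpa using h

/-- **Excess entropy production rate as minus the time derivative of the KL divergence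
to the pseudo canonical distribution.** With pseudo energy `U* = (−φ − μT log P)/μ`,
`Z = ∫ exp(−U*/T) ∈ (0,∞)`, `P^pcan = exp(−U*/T)/Z`, and `q = −∇·((∇φ)P)`
(representing `∂_τ P_τ`), one has
`σ^ex = (1/(μT))∫‖∇φ‖²P dx = −∫ q·log(P/P^pcan) dx`. -/
theorem excess_entropy_production_eq_neg_dt_kl {d : ℕ} (μ T : ℝ)
    (hμ : 0 < μ) (hT : 0 < T)
    (P : EuclideanSpace ℝ (Fin d) → ℝ)
    (hP : ContDiff ℝ (⊤ : ℕ∞) P) (hPpos : ∀ x, 0 < P x) (hPone : (∫ x, P x) = 1)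
    (φ : EuclideanSpace ℝ (Fin d) → ℝ) (hφ : ContDiff ℝ (⊤ : ℕ∞) φ)
    (Ustar : EuclideanSpace ℝ (Fin d) → ℝ)
    (hUstar : ∀ x, Ustar x = (-φ x - μ * T * Real.log (P x)) / μ)
    (Z : ℝ)
    (hZint : Integrable (fun x => Real.exp (-Ustar x / T)))
    (hZ : Z = ∫ x, Real.exp (-Ustar x / T)) (hZpos : 0 < Z)
    (Ppcan : EuclideanSpace ℝ (Fin d) → ℝ)
    (hPpcan : ∀ x, Ppcan x = Real.exp (-Ustar x / T) / Z)
    (q : EuclideanSpace ℝ (Fin d) → ℝ)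
    (hq : ∀ x, q x = - diverg (fun y => P y • gradient φ y) x)
    (hsupp1 : HasCompactSupport (fun x => φ x • (P x • gradient φ x)))
    (hsupp2 : HasCompactSupport
      (fun x => Real.log (P x / Ppcan x) • (P x • gradient φ x)))
    (hqzero : (∫ x, q x) = 0)
    (hgrad2 : Integrable (fun x => ‖gradient φ x‖ ^ 2 * P x))
    (σex : ℝ) (hσex : σex = (1 / (μ * T)) * ∫ x, ‖gradient φ x‖ ^ 2 * P x) :
    σex = - ∫ x, q x * Real.log (P x / Ppcan x) := by
  have hg : ∀ x, Real.log (P x / Ppcan x) = Real.log Z - φ x / (μ * T) := by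
    intro x
    have hPx := hPpos x
    rw [hPpcan, Real.log_div hPx.ne' (by positivity), Real.log_div (by positivity) hZpos.ne',
      Real.log_exp, hUstar]
    field_simp
    ring
  set g : EuclideanSpace ℝ (Fin d) → ℝ := fun x => Real.log Z - φ x / (μ * T) with hgdef
  have hgC : ContDiff ℝ (⊤ : ℕ∞) g := contDiff_const.sub (hφ.div_const _)
  have hgradi : ∀ x i, gradient φ x i = fderiv ℝ φ x (EuclideanSpace.single i 1) := by
    intro x i
    have h : inner ℝ (gradient φ x) (EuclideanSpace.single i (1 : ℝ)) =
        fderiv ℝ φ x (EuclideanSpace.single i 1) := by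
      simp only [gradient, InnerProductSpace.toDual_symm_apply]
    rw [← h]
    rw [EuclideanSpace.inner_single_right]
    simp
  have hgradC : ∀ i, ContDiff ℝ 1 (fun x => gradient φ x i) := by
    intro i
    simp only [hgradi]
    exact ((hφ.of_le (m := 2) (WithTop.coe_le_coe.2 (le_top : (2 : ℕ∞) ≤ ⊤))).fderiv_right (m := 1) (by norm_num [one_add_one_eq_two])).clm_apply contDiff_const
  have hFC : ∀ i, ContDiff ℝ 1 (fun x => P x * gradient φ x i) := fun i =>
    (hP.of_le (by exact_mod_cast le_top)).mul (hgradC i)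
  have hgC1 : ContDiff ℝ 1 g := hgC.of_le (by exact_mod_cast le_top)
  have hsupp : ∀ i, HasCompactSupport (fun x => g x * (P x * gradient φ x i)) := by
    intro i
    have h := hsupp2.comp_left (g := fun v : EuclideanSpace ℝ (Fin d) => v i) (by simp)
    have e : (fun x => g x * (P x * gradient φ x i)) =
        (fun v : EuclideanSpace ℝ (Fin d) => v i) ∘
          (fun x => Real.log (P x / Ppcan x) • (P x • gradient φ x)) := by
      funext x
      simp [hg, hgdef]
    rw [e]
    exact h
  have key := fun i => integral_fderiv_compact_zero _ (hgC1.mul (hFC i)) (hsupp i)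
    (EuclideanSpace.single i 1)
  have hgd : ∀ x i, fderiv ℝ g x (EuclideanSpace.single i 1) =
      - (gradient φ x i) / (μ * T) := by
    intro x i
    have hd : HasFDerivAt φ (fderiv ℝ φ x) x := (hφ.differentiable (by simp) x).hasFDerivAt
    have h2 : HasFDerivAt g (-((μ * T)⁻¹ • fderiv ℝ φ x)) x := by
      have := (hd.const_smul (μ * T)⁻¹).const_sub (Real.log Z)
      refine this.congr_of_eventuallyEq (Filter.Eventually.of_forall fun y => ?_)
      simp [hgdef, div_eq_inv_mul]
    rw [h2.fderiv, hgradi]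
    simp [div_eq_inv_mul]
  have hpt : ∀ x, q x * Real.log (P x / Ppcan x) =
      -(∑ i, fderiv ℝ (fun y => g y * (P y * gradient φ y i)) x (EuclideanSpace.single i 1))
        - (1 / (μ * T)) * (‖gradient φ x‖ ^ 2 * P x) := by
    intro x
    rw [hq, hg, EuclideanSpace.norm_sq_eq, diverg]
    have h1 : ∀ i, fderiv ℝ (fun y => g y * (P y * gradient φ y i)) x
        (EuclideanSpace.single i 1) =
        g x * fderiv ℝ (fun y => P y * gradient φ y i) x (EuclideanSpace.single i 1)
          - (1 / (μ * T)) * (‖gradient φ x i‖ ^ 2 * P x) := by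
      intro i
      rw [fderiv_fun_mul (hgC1.differentiable one_ne_zero x)
        ((hFC i).differentiable one_ne_zero x)]
      simp only [add_apply, smul_apply, smul_eq_mul, hgd,
        Real.norm_eq_abs, sq_abs]
      ring
    simp only [h1, Finset.sum_sub_distrib, ← Finset.mul_sum, ← Finset.sum_mul, PiLp.smul_apply,
      smul_eq_mul]
    simp only [hgdef]
    ring
  simp only [hpt]
  have hI : Integrable (fun x => -∑ i, fderiv ℝ (fun y => g y * (P y * gradient φ y i)) x
      (EuclideanSpace.single i 1)) := (integrable_finsetSum _ fun i _ => (key i).1).neg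
  rw [integral_sub hI (hgrad2.const_mul _),
    integral_neg, integral_finsetSum _ fun i _ => (key i).1, integral_const_mul, hσex]
  simp [fun i => (key i).2]
end

section
/- Let P : ℝ^d → ℝ be a strictly positive probability density and let q : ℝ^d → ℝ be an integrable function with ∫ q dx = 0 (representing ∂_t P_t) and ∫ q²/P dx < ∞. Let r : ℝ^d → ℝ be measurable with ∫ r² P dx < ∞ and Var_P(r) > 0. Define the intrinsic speed v_info = √(∫ q(x)²/P(x) dx) and the speed of the observable v_r = |∫ r(x) q(x) dx| / √(Var_P(r)). Then v_info ≥ v_r. -/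
open MeasureTheory

/-- **The intrinsic speed bounds the speed of any observable.**
For a strictly positive probability density `P`, a function `q` with `∫ q dx = 0`
(representing `∂_t P_t`) and finite Fisher information `∫ q²/P dx`, and an observable
`r` with `∫ r²P dx < ∞` and positive variance, the intrinsic speed
`v_info = √(∫ q²/P dx)` bounds the speed of the observable
`v_r = |∫ r q dx|/√(Var_P(r))`: `v_info ≥ v_r`. -/
theorem intrinsic_speed_bounds_observable_speed {d : ℕ}
    (P : EuclideanSpace ℝ (Fin d) → ℝ)
    (hPmeas : Measurable P) (hPpos : ∀ x, 0 < P x) (hPone : (∫ x, P x) = 1)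
    (q : EuclideanSpace ℝ (Fin d) → ℝ)
    (hqint : Integrable q) (hqzero : (∫ x, q x) = 0)
    (hFisher : Integrable (fun x => q x ^ 2 / P x))
    (r : EuclideanSpace ℝ (Fin d) → ℝ) (hrmeas : Measurable r)
    (hr2 : Integrable (fun x => r x ^ 2 * P x))
    (hrq : Integrable (fun x => r x * q x))
    (VarR : ℝ) (hVar : VarR = ∫ x, (r x - ∫ y, r y * P y) ^ 2 * P x)
    (hVarpos : 0 < VarR)
    (vinfo : ℝ) (hvinfo : vinfo = Real.sqrt (∫ x, q x ^ 2 / P x))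
    (vr : ℝ) (hvr : vr = |∫ x, r x * q x| / Real.sqrt VarR) :
    vinfo ≥ vr := by
  set m := ∫ y, r y * P y with hm
  have hV : Integrable (fun x => (r x - m) ^ 2 * P x) := by
    by_contra h
    rw [integral_undef h] at hVar
    linarith
  have hB : Integrable (fun x => r x * q x - m * q x) := hrq.sub (hqint.const_mul m)
  have hBval : (∫ x, (r x * q x - m * q x)) = ∫ x, r x * q x := by
    rw [integral_sub hrq (hqint.const_mul m), integral_const_mul, hqzero]
    ring
  set B := ∫ x, r x * q x with hBdef
  set F := ∫ x, q x ^ 2 / P x with hF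
  have key : ∀ t : ℝ, 0 ≤ F - (2 * t) * B + t ^ 2 * VarR := by
    intro t
    have h1 : (∫ x, ((q x ^ 2 / P x - (2 * t) * (r x * q x - m * q x))
        + t ^ 2 * ((r x - m) ^ 2 * P x))) = F - (2 * t) * B + t ^ 2 * VarR := by
      have h0 : Integrable (fun x => q x ^ 2 / P x - (2 * t) * (r x * q x - m * q x)) :=
        hFisher.sub (hB.const_mul (2 * t))
      rw [integral_add h0 (hV.const_mul (t ^ 2)),
        integral_sub hFisher (hB.const_mul (2 * t)), integral_const_mul, integral_const_mul,
        hBval, ← hVar]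
    rw [← h1]
    refine integral_nonneg fun x => ?_
    have hp := hPpos x
    have h2 : (q x ^ 2 / P x - (2 * t) * (r x * q x - m * q x)) + t ^ 2 * ((r x - m) ^ 2 * P x)
        = (q x - t * (r x - m) * P x) ^ 2 / P x := by
      field_simp
      ring
    simp only [Pi.zero_apply]
    rw [h2]
    positivity
  have h3 := key (B / VarR)
  have h4 : F - (2 * (B / VarR)) * B + (B / VarR) ^ 2 * VarR = F - B ^ 2 / VarR := by
    field_simp
    ring
  rw [h4] at h3
  rw [hvinfo, hvr, ge_iff_le]
  apply Real.le_sqrt_of_sq_le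
  rw [div_pow, sq_abs, Real.sq_sqrt hVarpos.le]
  linarith
end

section
/- Let P : ℝ^d → ℝ be a strictly positive probability density, let q : ℝ^d → ℝ be integrable with ∫ q dx = 0 and ∫ q²/P dx < ∞ (q representing ∂_t P_t), and let θ : ℝ^d → ℝ be measurable with ∫ θ² P dx < ∞ (θ representing log(P_t/P^pcan_t)). Define the excess entropy production rate σ^ex = −∫ q(x) θ(x) dx, the intrinsic speed v_info = √(∫ q²/P dx), and Var_P(θ) = ∫ (θ − ∫θP dx)² P dx. Then σ^ex ≤ v_info · √(Var_P(θ)). -/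
open MeasureTheory

/-- **The intrinsic speed bounds the excess entropy production rate.**
For a strictly positive probability density `P`, a function `q` with `∫ q dx = 0`
(representing `∂_t P_t`) and finite Fisher information `∫ q²/P dx`, and a theta
coordinate `θ` (representing `log(P_t/P^pcan_t)`) with `∫ θ²P dx < ∞`, the excess
entropy production rate `σ^ex = −∫ qθ dx` satisfies
`σ^ex ≤ v_info·√(Var_P(θ))` where `v_info = √(∫ q²/P dx)`. -/
theorem excess_entropy_production_bounded_by_intrinsic_speed {d : ℕ}
    (P : EuclideanSpace ℝ (Fin d) → ℝ)
    (hPmeas : Measurable P) (hPpos : ∀ x, 0 < P x) (hPone : (∫ x, P x) = 1)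
    (q : EuclideanSpace ℝ (Fin d) → ℝ)
    (hqint : Integrable q) (hqzero : (∫ x, q x) = 0)
    (hFisher : Integrable (fun x => q x ^ 2 / P x))
    (θ : EuclideanSpace ℝ (Fin d) → ℝ) (hθmeas : Measurable θ)
    (hθ2 : Integrable (fun x => θ x ^ 2 * P x))
    (hqθ : Integrable (fun x => q x * θ x))
    (σex : ℝ) (hσex : σex = - ∫ x, q x * θ x)
    (vinfo : ℝ) (hvinfo : vinfo = Real.sqrt (∫ x, q x ^ 2 / P x))
    (VarTheta : ℝ) (hVar : VarTheta = ∫ x, (θ x - ∫ y, θ y * P y) ^ 2 * P x) :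
    σex ≤ vinfo * Real.sqrt VarTheta := by
  have hP : Integrable P := by
    by_contra h
    rw [integral_undef h] at hPone
    exact zero_ne_one hPone
  have hθP : Integrable (fun x => θ x * P x) := by
    refine (hθ2.add hP).mono' (hθmeas.mul hPmeas).aestronglyMeasurable ?_
    refine Filter.Eventually.of_forall fun x => ?_
    have h1 := hPpos x
    have h2 : |θ x| ≤ θ x ^ 2 + 1 := by
      rw [← sq_abs]
      nlinarith [sq_nonneg (|θ x| - 1), abs_nonneg (θ x)]
    have h3 := mul_le_mul_of_nonneg_right h2 h1.le
    simp only [Real.norm_eq_abs, abs_mul, abs_of_pos h1, Pi.add_apply]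
    linarith
  set m := ∫ y, θ y * P y with hm
  have hV : Integrable (fun x => (θ x - m) ^ 2 * P x) := by
    have h := (hθ2.sub (hθP.const_mul (2 * m))).add (hP.const_mul (m ^ 2))
    refine h.congr (Filter.Eventually.of_forall fun x => ?_)
    simp only [Pi.add_apply, Pi.sub_apply]
    ring
  have hC : Integrable (fun x => q x * (θ x - m)) := by
    refine (hqθ.sub (hqint.const_mul m)).congr (Filter.Eventually.of_forall fun x => ?_)
    simp only [Pi.sub_apply]
    ring
  have hCeq : (∫ x, q x * (θ x - m)) = ∫ x, q x * θ x := by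
    have h : (∫ x, q x * (θ x - m)) = ∫ x, (q x * θ x - m * q x) := by
      congr 1
      ext x
      ring
    rw [h, integral_sub hqθ (hqint.const_mul m), integral_const_mul, hqzero]
    ring
  have key : ∀ t : ℝ, 0 ≤ VarTheta * (t * t) + (2 * ∫ x, q x * θ x) * t
      + ∫ x, q x ^ 2 / P x := by
    intro t
    have h : (∫ x, (((t * t) * ((θ x - m) ^ 2 * P x) + (2 * t) * (q x * (θ x - m)))
        + q x ^ 2 / P x)) = VarTheta * (t * t) + (2 * ∫ x, q x * θ x) * t
      + ∫ x, q x ^ 2 / P x := by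
      have hS : Integrable (fun x => (t * t) * ((θ x - m) ^ 2 * P x)
          + (2 * t) * (q x * (θ x - m))) :=
        (hV.const_mul (t * t)).add (hC.const_mul (2 * t))
      rw [integral_add hS hFisher,
        integral_add (hV.const_mul _) (hC.const_mul _), integral_const_mul,
        integral_const_mul, hCeq, hVar]
      ring
    rw [← h]
    refine integral_nonneg fun x => ?_
    have h1 := hPpos x
    have h2 : (t * t) * ((θ x - m) ^ 2 * P x) + (2 * t) * (q x * (θ x - m))
        + q x ^ 2 / P x = (q x + t * (θ x - m) * P x) ^ 2 / P x := by
      field_simp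
      ring
    simp only [Pi.zero_apply]
    rw [h2]
    positivity
  have hd := discrim_le_zero key
  unfold discrim at hd
  have hA : 0 ≤ ∫ x, q x ^ 2 / P x :=
    integral_nonneg fun x => div_nonneg (sq_nonneg _) (hPpos x).le
  rw [hσex, hvinfo, ← Real.sqrt_mul hA]
  apply Real.le_sqrt_of_sq_le
  nlinarith
end

section
/- Let μ, T > 0, let P be a smooth probability density on ℝ^d, let ν be a smooth vector field, and let φ be smooth with ν* := ∇φ satisfying ∇·((ν − ν*)·P) = 0. Let v : ℝ^d → ℝ^d be any smooth vector field with ∇·(v·P) = 0 such that φ·(ν − ν* − v)·P has compact support, and assume all the integrals below are finite. Then the generalized Pythagorean identity holds: ∫ ‖ν − v‖² P dx = ∫ ‖ν*‖² P dx + ∫ ‖ν − ν* − v‖² P dx. Consequently, the infimum of (1/(4μT))∫‖ν − v‖²P dx over all such zero-divergence v is attained at v = ν − ν* and equals (1/(4μT))∫‖ν*‖²P dx, i.e., one quarter of μT times the excess entropy production rate σ^ex = (1/(μT))∫‖ν*‖²P dx. -/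
open MeasureTheory

theorem aux_diverg_integral {d : ℕ}
    (F : EuclideanSpace ℝ (Fin d) → EuclideanSpace ℝ (Fin d))
    (hF : ContDiff ℝ (⊤ : ℕ∞) F) (hc : HasCompactSupport F) :
    Integrable (fun x => diverg F x) ∧ ∫ x, diverg F x = 0 := by
  have hFi : ∀ i, ContDiff ℝ (⊤ : ℕ∞) (fun y => F y i) := fun i => by fun_prop
  have hci : ∀ i, HasCompactSupport (fun y => F y i) := fun i =>
    hc.comp_left (g := fun z : EuclideanSpace ℝ (Fin d) => z i) rfl
  have hint : ∀ i, Integrable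
      (fun x => fderiv ℝ (fun y => F y i) x (EuclideanSpace.single i 1)) := by
    intro i
    apply Continuous.integrable_of_hasCompactSupport
    · exact ((hFi i).continuous_fderiv (by simp)).clm_apply continuous_const
    · exact (hci i).fderiv_apply ℝ _
  have hzero : ∀ i, ∫ x, fderiv ℝ (fun y => F y i) x (EuclideanSpace.single i 1) = 0 := by
    intro i
    have h := integral_mul_fderiv_eq_neg_fderiv_mul_of_integrable
      (μ := (volume : Measure (EuclideanSpace ℝ (Fin d))))
      (f := fun _ : EuclideanSpace ℝ (Fin d) => (1:ℝ)) (g := fun y => F y i)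
      (v := EuclideanSpace.single i 1) (by simp) (by simpa using hint i)
      (by simpa using (hFi i).continuous.integrable_of_hasCompactSupport (hci i))
      (by fun_prop) (by exact fun x _ => ((hFi i).differentiable (by simp)) x)
    simpa using h
  unfold diverg
  refine ⟨integrable_finsetSum _ fun i _ => hint i, ?_⟩
  rw [integral_finsetSum _ fun i _ => hint i]
  simp [hzero]

theorem aux_gradient_smooth {d : ℕ} (φ : EuclideanSpace ℝ (Fin d) → ℝ)
    (hφ : ContDiff ℝ (⊤ : ℕ∞) φ) : ContDiff ℝ (⊤ : ℕ∞) (fun x => gradient φ x) := by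
  unfold gradient
  exact (InnerProductSpace.toDual ℝ (EuclideanSpace ℝ (Fin d))).symm.contDiff.comp
    (hφ.fderiv_right (m := (⊤ : ℕ∞)) (by simp))

theorem aux_diverg_sub {d : ℕ}
    (F G : EuclideanSpace ℝ (Fin d) → EuclideanSpace ℝ (Fin d))
    (hF : ContDiff ℝ (⊤ : ℕ∞) F) (hG : ContDiff ℝ (⊤ : ℕ∞) G) (x) :
    diverg (fun y => F y - G y) x = diverg F x - diverg G x := by
  have hF' : Differentiable ℝ F := hF.differentiable (by simp)
  have hG' : Differentiable ℝ G := hG.differentiable (by simp)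
  unfold diverg
  rw [← Finset.sum_sub_distrib]
  refine Finset.sum_congr rfl fun i _ => ?_
  have : (fun y => (F y - G y) i) = (fun y => F y i) - (fun y => G y i) := by
    ext y; simp
  rw [this, fderiv_sub (by fun_prop) (by fun_prop)]
  simp

theorem aux_diverg_smul {d : ℕ} (φ : EuclideanSpace ℝ (Fin d) → ℝ)
    (F : EuclideanSpace ℝ (Fin d) → EuclideanSpace ℝ (Fin d))
    (hφ : ContDiff ℝ (⊤ : ℕ∞) φ) (hF : ContDiff ℝ (⊤ : ℕ∞) F) (x) :
    diverg (fun y => φ y • F y) x = φ x * diverg F x + inner ℝ (gradient φ x) (F x) := by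
  have hF' : Differentiable ℝ F := hF.differentiable (by simp)
  have hφ' : Differentiable ℝ φ := hφ.differentiable (by simp)
  have hin : inner ℝ (gradient φ x) (F x)
      = ∑ i, F x i * fderiv ℝ φ x (EuclideanSpace.single i 1) := by
    rw [gradient, InnerProductSpace.toDual_symm_apply]
    conv_lhs => rw [← (EuclideanSpace.basisFun (Fin d) ℝ).sum_repr (F x)]
    simp [map_sum]
  rw [hin]
  unfold diverg
  rw [Finset.mul_sum, ← Finset.sum_add_distrib]
  refine Finset.sum_congr rfl fun i _ => ?_
  have : (fun y => (φ y • F y) i) = φ * (fun y => F y i) := by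
    ext y; simp
  rw [this, fderiv_mul (by fun_prop) (by fun_prop)]
  simp

/-- **Projection onto the zero-divergence manifold yields the excess entropy production
rate.** With `ν* = ∇φ` and `∇·((ν−ν*)P) = 0`: for every smooth zero-divergence `v`
(i.e. `∇·(vP) = 0`) with `φ(ν−ν*−v)P` compactly supported, the Pythagorean identity
`∫‖ν−v‖²P = ∫‖ν*‖²P + ∫‖ν−ν*−v‖²P` holds; and the infimum of `(1/(4μT))∫‖ν−v‖²P`
over all such `v` is attained at `v = ν−ν*` with value `(1/(4μT))∫‖ν*‖²P = μT·σ^ex/4`. -/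
theorem projection_zero_divergence_manifold {d : ℕ} (μ T : ℝ)
    (hμ : 0 < μ) (hT : 0 < T)
    (P : EuclideanSpace ℝ (Fin d) → ℝ)
    (hP : ContDiff ℝ (⊤ : ℕ∞) P) (hPnonneg : ∀ x, 0 ≤ P x) (hPone : (∫ x, P x) = 1)
    (ν : EuclideanSpace ℝ (Fin d) → EuclideanSpace ℝ (Fin d)) (hν : ContDiff ℝ (⊤ : ℕ∞) ν)
    (φ : EuclideanSpace ℝ (Fin d) → ℝ) (hφ : ContDiff ℝ (⊤ : ℕ∞) φ)
    (νstar : EuclideanSpace ℝ (Fin d) → EuclideanSpace ℝ (Fin d))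
    (hνstar : ∀ x, νstar x = gradient φ x)
    (hzerodiv : ∀ x, diverg (fun y => P y • (ν y - νstar y)) x = 0)
    (hν2 : Integrable (fun x => ‖ν x‖ ^ 2 * P x))
    (hνstar2 : Integrable (fun x => ‖νstar x‖ ^ 2 * P x)) :
    (∀ v : EuclideanSpace ℝ (Fin d) → EuclideanSpace ℝ (Fin d),
      ContDiff ℝ (⊤ : ℕ∞) v →
      (∀ x, diverg (fun y => P y • v y) x = 0) →
      HasCompactSupport (fun x => φ x • (P x • (ν x - νstar x - v x))) →
      Integrable (fun x => ‖ν x - v x‖ ^ 2 * P x) →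
      Integrable (fun x => ‖ν x - νstar x - v x‖ ^ 2 * P x) →
      (∫ x, ‖ν x - v x‖ ^ 2 * P x)
        = (∫ x, ‖νstar x‖ ^ 2 * P x) + ∫ x, ‖ν x - νstar x - v x‖ ^ 2 * P x) ∧
    IsLeast { A : ℝ | ∃ v : EuclideanSpace ℝ (Fin d) → EuclideanSpace ℝ (Fin d),
        ContDiff ℝ (⊤ : ℕ∞) v ∧
        (∀ x, diverg (fun y => P y • v y) x = 0) ∧
        HasCompactSupport (fun x => φ x • (P x • (ν x - νstar x - v x))) ∧
        Integrable (fun x => ‖ν x - v x‖ ^ 2 * P x) ∧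
        Integrable (fun x => ‖ν x - νstar x - v x‖ ^ 2 * P x) ∧
        A = (1 / (4 * μ * T)) * ∫ x, ‖ν x - v x‖ ^ 2 * P x }
      ((1 / (4 * μ * T)) * ∫ x, ‖νstar x‖ ^ 2 * P x) := by
  have hs : ContDiff ℝ (⊤ : ℕ∞) νstar := by
    have : νstar = fun x => gradient φ x := funext hνstar
    rw [this]
    exact aux_gradient_smooth φ hφ
  have main : ∀ v : EuclideanSpace ℝ (Fin d) → EuclideanSpace ℝ (Fin d),
      ContDiff ℝ (⊤ : ℕ∞) v →
      (∀ x, diverg (fun y => P y • v y) x = 0) →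
      HasCompactSupport (fun x => φ x • (P x • (ν x - νstar x - v x))) →
      Integrable (fun x => ‖ν x - v x‖ ^ 2 * P x) →
      Integrable (fun x => ‖ν x - νstar x - v x‖ ^ 2 * P x) →
      (∫ x, ‖ν x - v x‖ ^ 2 * P x)
        = (∫ x, ‖νstar x‖ ^ 2 * P x) + ∫ x, ‖ν x - νstar x - v x‖ ^ 2 * P x := by
    intro v hv hdv hc _ hi2
    have hw : ∀ x, diverg (fun y => P y • (ν y - νstar y - v y)) x = 0 := by
      intro x
      have h := aux_diverg_sub (fun y => P y • (ν y - νstar y)) (fun y => P y • v y)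
        (by fun_prop) (by fun_prop) x
      rw [hzerodiv, hdv, sub_zero] at h
      simpa only [smul_sub] using h
    have hdiv : ∀ x, diverg (fun y => φ y • (P y • (ν y - νstar y - v y))) x
        = inner ℝ (νstar x) (P x • (ν x - νstar x - v x)) := by
      intro x
      rw [aux_diverg_smul φ (fun y => P y • (ν y - νstar y - v y)) hφ (by fun_prop) x, hw,
        hνstar]
      simp
    obtain ⟨h1, h2⟩ := aux_diverg_integral _ (by fun_prop) hc
    simp only [hdiv] at h1 h2
    have hpt : ∀ x, ‖ν x - v x‖ ^ 2 * P x = ‖νstar x‖ ^ 2 * P x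
        + 2 * inner ℝ (νstar x) (P x • (ν x - νstar x - v x))
        + ‖ν x - νstar x - v x‖ ^ 2 * P x := by
      intro x
      have : ν x - v x = νstar x + (ν x - νstar x - v x) := by abel
      rw [this, norm_add_sq_real, inner_smul_right]
      ring
    simp only [hpt]
    rw [integral_add (by exact hνstar2.add (h1.const_mul 2)) hi2,
      integral_add hνstar2 (h1.const_mul 2), integral_const_mul, h2]
    ring
  refine ⟨main, ⟨fun x => ν x - νstar x, by fun_prop, hzerodiv, ?_, ?_, ?_, ?_⟩, ?_⟩
  · simp only [sub_self, smul_zero]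
    exact HasCompactSupport.zero
  · simpa using hνstar2
  · simp
  · simp
  · rintro A ⟨v, hv, hdv, hc, hi1, hi2, rfl⟩
    rw [main v hv hdv hc hi1 hi2]
    have : 0 ≤ ∫ x, ‖ν x - νstar x - v x‖ ^ 2 * P x :=
      integral_nonneg fun x => mul_nonneg (by positivity) (hPnonneg x)
    apply mul_le_mul_of_nonneg_left _ (by positivity)
    linarith
end

section
/- Let μ, T > 0, let P be a smooth probability density on ℝ^d, let ν be a smooth vector field, and let φ be smooth with ν* := ∇φ satisfying ∇·((ν − ν*)·P) = 0. Let r : ℝ^d → ℝ be any smooth function such that (r − φ)·(ν − ν*)·P has compact support, and assume all the integrals below are finite. Then the generalized Pythagorean identity holds: ∫ ‖ν − ∇r‖² P dx = ∫ ‖ν − ν*‖² P dx + ∫ ‖∇r − ∇φ‖² P dx. Consequently, the infimum of (1/(4μT))∫‖ν − ∇r‖²P dx over all such r is attained at r = φ and equals (1/(4μT))∫‖ν − ν*‖²P dx, i.e., one quarter of μT times the housekeeping entropy production rate σ^hk = (1/(μT))∫‖ν − ν*‖²P dx. -/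
open MeasureTheory

theorem integral_diverg_aux {d : ℕ}
    (V : EuclideanSpace ℝ (Fin d) → EuclideanSpace ℝ (Fin d))
    (hV : ContDiff ℝ 1 V) (hc : HasCompactSupport V) :
    Integrable (diverg V) ∧ (∫ x, diverg V x) = 0 := by
  have hVi : ∀ i, ContDiff ℝ 1 (fun y => V y i) := fun i => by fun_prop
  have hci : ∀ i, HasCompactSupport (fun y => V y i) := fun i =>
    hc.comp_left (g := fun v : EuclideanSpace ℝ (Fin d) => v i) rfl
  have hint : ∀ i, Integrable
      (fun x => fderiv ℝ (fun y => V y i) x (EuclideanSpace.single i 1)) := fun i => by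
    apply Continuous.integrable_of_hasCompactSupport
    · exact ((hVi i).continuous_fderiv (by norm_num)).clm_apply continuous_const
    · exact (hci i).fderiv_apply ℝ _
  have hz : ∀ i, (∫ x, fderiv ℝ (fun y => V y i) x (EuclideanSpace.single i 1)) = 0 := fun i => by
    have := integral_mul_fderiv_eq_neg_fderiv_mul_of_integrable
      (μ := (volume : Measure (EuclideanSpace ℝ (Fin d)))) (𝕜 := ℝ)
      (f := fun _ => (1 : ℝ)) (g := fun y => V y i) (v := EuclideanSpace.single i 1)
      (by simp) (by simpa using hint i)
      (by simpa using (hVi i).continuous.integrable_of_hasCompactSupport (hci i))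
      (by intros; fun_prop)
      (fun x _ => ((hVi i).differentiable (by norm_num)) x)
    simpa using this
  refine ⟨?_, ?_⟩
  · unfold diverg
    exact integrable_finsetSum _ (fun i _ => hint i)
  · unfold diverg
    rw [integral_finsetSum _ (fun i _ => hint i)]
    exact Finset.sum_eq_zero (fun i _ => hz i)

theorem inner_gradient_aux {d : ℕ} (f : EuclideanSpace ℝ (Fin d) → ℝ)
    (x v : EuclideanSpace ℝ (Fin d)) : inner ℝ (gradient f x) v = fderiv ℝ f x v := by
  rw [← toDual_gradient, InnerProductSpace.toDual_apply_apply]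

theorem diverg_smul_aux {d : ℕ} (f : EuclideanSpace ℝ (Fin d) → ℝ)
    (w : EuclideanSpace ℝ (Fin d) → EuclideanSpace ℝ (Fin d))
    (hf : Differentiable ℝ f) (hw : Differentiable ℝ w) (x : EuclideanSpace ℝ (Fin d)) :
    diverg (fun y => f y • w y) x = f x * diverg w x + fderiv ℝ f x (w x) := by
  have hwi : ∀ i, Differentiable ℝ (fun y => w y i) := fun i => by fun_prop
  have hx : w x = ∑ i, (w x i) • EuclideanSpace.single i (1 : ℝ) := by
    ext j
    simp [Finset.sum_apply, Pi.single_apply]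
  have h1 : ∀ i, fderiv ℝ (fun y => (f y • w y) i) x (EuclideanSpace.single i 1)
      = f x * fderiv ℝ (fun y => w y i) x (EuclideanSpace.single i 1)
        + w x i * fderiv ℝ f x (EuclideanSpace.single i 1) := fun i => by
    have : (fun y => (f y • w y) i) = fun y => f y * w y i := by ext y; simp
    rw [this, fderiv_fun_mul (hf x) (hwi i x)]
    simp
  unfold diverg
  simp_rw [h1]
  rw [Finset.sum_add_distrib, ← Finset.mul_sum]
  congr 1
  conv_rhs => rw [hx]
  simp [map_sum]

theorem contDiff_gradient_aux {d : ℕ} (f : EuclideanSpace ℝ (Fin d) → ℝ)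
    (hf : ContDiff ℝ (⊤ : ℕ∞) f) : ContDiff ℝ 1 (gradient f) := by
  have h : ContDiff ℝ 1 (fderiv ℝ f) := hf.fderiv_right (by norm_cast)
  exact ((InnerProductSpace.toDual ℝ (EuclideanSpace ℝ (Fin d))).symm.toContinuousLinearEquiv.contDiff).comp h

/-- **Projection onto the gradient manifold yields the housekeeping entropy production
rate.** With `ν* = ∇φ` and `∇·((ν−ν*)P) = 0`: for every smooth `r` with `(r−φ)(ν−ν*)P`
compactly supported, the Pythagorean identity
`∫‖ν−∇r‖²P = ∫‖ν−ν*‖²P + ∫‖∇r−∇φ‖²P` holds; and the infimum of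
`(1/(4μT))∫‖ν−∇r‖²P` over all such `r` is attained at `r = φ` with value
`(1/(4μT))∫‖ν−ν*‖²P = μT·σ^hk/4`. -/
theorem projection_gradient_manifold {d : ℕ} (μ T : ℝ)
    (hμ : 0 < μ) (hT : 0 < T)
    (P : EuclideanSpace ℝ (Fin d) → ℝ)
    (hP : ContDiff ℝ (⊤ : ℕ∞) P) (hPnonneg : ∀ x, 0 ≤ P x) (hPone : (∫ x, P x) = 1)
    (ν : EuclideanSpace ℝ (Fin d) → EuclideanSpace ℝ (Fin d)) (hν : ContDiff ℝ (⊤ : ℕ∞) ν)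
    (φ : EuclideanSpace ℝ (Fin d) → ℝ) (hφ : ContDiff ℝ (⊤ : ℕ∞) φ)
    (νstar : EuclideanSpace ℝ (Fin d) → EuclideanSpace ℝ (Fin d))
    (hνstar : ∀ x, νstar x = gradient φ x)
    (hzerodiv : ∀ x, diverg (fun y => P y • (ν y - νstar y)) x = 0)
    (hν2 : Integrable (fun x => ‖ν x‖ ^ 2 * P x))
    (hhk2 : Integrable (fun x => ‖ν x - νstar x‖ ^ 2 * P x)) :
    (∀ r : EuclideanSpace ℝ (Fin d) → ℝ,
      ContDiff ℝ (⊤ : ℕ∞) r →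
      HasCompactSupport (fun x => (r x - φ x) • (P x • (ν x - νstar x))) →
      Integrable (fun x => ‖ν x - gradient r x‖ ^ 2 * P x) →
      Integrable (fun x => ‖gradient r x - gradient φ x‖ ^ 2 * P x) →
      (∫ x, ‖ν x - gradient r x‖ ^ 2 * P x)
        = (∫ x, ‖ν x - νstar x‖ ^ 2 * P x)
          + ∫ x, ‖gradient r x - gradient φ x‖ ^ 2 * P x) ∧
    IsLeast { A : ℝ | ∃ r : EuclideanSpace ℝ (Fin d) → ℝ,
        ContDiff ℝ (⊤ : ℕ∞) r ∧
        HasCompactSupport (fun x => (r x - φ x) • (P x • (ν x - νstar x))) ∧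
        Integrable (fun x => ‖ν x - gradient r x‖ ^ 2 * P x) ∧
        Integrable (fun x => ‖gradient r x - gradient φ x‖ ^ 2 * P x) ∧
        A = (1 / (4 * μ * T)) * ∫ x, ‖ν x - gradient r x‖ ^ 2 * P x }
      ((1 / (4 * μ * T)) * ∫ x, ‖ν x - νstar x‖ ^ 2 * P x) := by
  have key : ∀ r : EuclideanSpace ℝ (Fin d) → ℝ,
      ContDiff ℝ (⊤ : ℕ∞) r →
      HasCompactSupport (fun x => (r x - φ x) • (P x • (ν x - νstar x))) →
      Integrable (fun x => ‖ν x - gradient r x‖ ^ 2 * P x) →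
      Integrable (fun x => ‖gradient r x - gradient φ x‖ ^ 2 * P x) →
      (∫ x, ‖ν x - gradient r x‖ ^ 2 * P x)
        = (∫ x, ‖ν x - νstar x‖ ^ 2 * P x)
          + ∫ x, ‖gradient r x - gradient φ x‖ ^ 2 * P x := by
    intro r hr hc _ h2
    have hs : ContDiff ℝ 1 νstar := by
      rw [funext hνstar]; exact contDiff_gradient_aux φ hφ
    have hle : (1 : WithTop ℕ∞) ≤ ((⊤ : ℕ∞) : WithTop ℕ∞) := by norm_cast
    have hr1 := hr.of_le hle
    have hφ1 := hφ.of_le hle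
    have hw : ContDiff ℝ 1 (fun x => P x • (ν x - νstar x)) :=
      (hP.of_le hle).smul ((hν.of_le hle).sub hs)
    have hf : ContDiff ℝ 1 (fun x => r x - φ x) := hr1.sub hφ1
    have hdr := hr1.differentiable one_ne_zero
    have hdφ := hφ1.differentiable one_ne_zero
    obtain ⟨hi, h0⟩ := integral_diverg_aux _ (hf.smul hw) hc
    have hd : ∀ x, diverg (fun x => (r x - φ x) • (P x • (ν x - νstar x))) x
        = P x * inner ℝ (gradient r x - gradient φ x) (ν x - νstar x) := fun x => by
      rw [diverg_smul_aux (fun x => r x - φ x) _ (hf.differentiable one_ne_zero)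
        (hw.differentiable one_ne_zero), hzerodiv,
        fderiv_fun_sub (hdr x) (hdφ x), inner_sub_left, inner_gradient_aux, inner_gradient_aux]
      simp [mul_sub]
    have hpt : ∀ x, ‖ν x - gradient r x‖ ^ 2 * P x
        = (‖ν x - νstar x‖ ^ 2 * P x + ‖gradient r x - gradient φ x‖ ^ 2 * P x)
          - 2 * diverg (fun x => (r x - φ x) • (P x • (ν x - νstar x))) x := fun x => by
      have : ν x - gradient r x = (ν x - νstar x) - (gradient r x - gradient φ x) := by
        rw [hνstar]; abel
      rw [hd, this, norm_sub_sq_real, real_inner_comm]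
      ring
    have hi2 : Integrable (fun x =>
      2 * diverg (fun x => (r x - φ x) • (P x • (ν x - νstar x))) x) := hi.const_mul 2
    have h0' : (∫ x, diverg (fun x => (r x - φ x) • (P x • (ν x - νstar x))) x) = 0 := h0
    have h3 : Integrable (fun x => ‖ν x - νstar x‖ ^ 2 * P x
      + ‖gradient r x - gradient φ x‖ ^ 2 * P x) := hhk2.add h2
    simp_rw [hpt]
    rw [integral_sub h3 hi2, integral_add hhk2 h2, integral_const_mul, h0']
    ring
  refine ⟨key, ⟨φ, hφ, ?_, ?_, ?_, ?_⟩, ?_⟩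
  · simp only [sub_self, zero_smul]
    exact (HasCompactSupport.zero :
      HasCompactSupport (0 : EuclideanSpace ℝ (Fin d) → EuclideanSpace ℝ (Fin d)))
  · simpa only [hνstar] using hhk2
  · simp
  · simp only [hνstar]
  · rintro A ⟨r, hr, hc, h1, h2, rfl⟩
    rw [key r hr hc h1 h2]
    apply mul_le_mul_of_nonneg_left _ (by positivity)
    have : 0 ≤ ∫ x, ‖gradient r x - gradient φ x‖ ^ 2 * P x :=
      integral_nonneg (fun x => mul_nonneg (sq_nonneg _) (hPnonneg x))
    linarith
end
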